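/- arXiv:1210.6612 — 2 statements merged into one kernel-verified Lean document; each statement's English description precedes it below -/
import Mathlib

section
/- The only rational points (X : Y : 1) on the elliptic curve Y² = X³ + 5X² + 4X with Y ≠ 0 are (−2, ±2) and (2, ±6). -/
lemma mod3_aux (p z t : ℤ) (h : IsCoprime p z) (e : p ^ 2 + z ^ 2 = 3 * t) : False := by
  have h3 : (3 : ℤ) ∣ p ∧ (3 : ℤ) ∣ z := by
    have hm : (p ^ 2 + z ^ 2) % 3 = 0 := by omega
    rcases (by omega : p % 3 = 0 ∨ p % 3 = 1 ∨ p % 3 = 2) with h1 | h1 | h1 <;>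
    rcases (by omega : z % 3 = 0 ∨ z % 3 = 1 ∨ z % 3 = 2) with h2 | h2 | h2 <;>
    simp [pow_two, Int.add_emod, Int.mul_emod, h1, h2] at hm <;> omega
  have := h.isUnit_of_dvd' h3.1 h3.2
  rw [Int.isUnit_iff] at this
  omega

lemma core_aux (p q t z : ℤ) (h1 : IsCoprime q t) (h2 : IsCoprime p z) (ht : t ≠ 0)
    (hq : q ≠ 0)
    (e : q ^ 2 * (p ^ 2 + z ^ 2) = t ^ 2 * (p ^ 2 + 4 * z ^ 2)) :
    p ^ 2 + z ^ 2 = t ^ 2 ∧ p ^ 2 + 4 * z ^ 2 = q ^ 2 := by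
  have hd : q ^ 2 ∣ p ^ 2 + 4 * z ^ 2 :=
    (h1.pow : IsCoprime (q ^ 2) (t ^ 2)).dvd_of_dvd_mul_left ⟨_, e.symm⟩
  obtain ⟨k, hk⟩ := hd
  have hA : p ^ 2 + z ^ 2 = t ^ 2 * k := by
    have : q ^ 2 ≠ 0 := pow_ne_zero _ hq
    apply mul_left_cancel₀ this
    rw [e, hk]; ring
  have hk3 : k ∣ 3 := by
    have a1 : k ∣ 3 * p ^ 2 := ⟨4 * t ^ 2 - q ^ 2, by linear_combination 4 * hA - hk⟩
    have a2 : k ∣ 3 * z ^ 2 := ⟨q ^ 2 - t ^ 2, by linear_combination hk - hA⟩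
    obtain ⟨a, b, hab⟩ := (h2.pow : IsCoprime (p ^ 2) (z ^ 2))
    have : (3 : ℤ) = a * (3 * p ^ 2) + b * (3 * z ^ 2) := by linear_combination -3 * hab
    rw [this]
    exact dvd_add (a1.mul_left _) (a2.mul_left _)
  have hk0 : 0 ≤ k := by
    have : 0 < t ^ 2 := by positivity
    by_contra hn
    nlinarith [sq_nonneg p, sq_nonneg z]
  have hk' : k ≤ 3 := Int.le_of_dvd (by norm_num) hk3
  have : k = 1 ∨ k = 3 := by interval_cases k <;> omega
  rcases this with rfl | rfl
  · constructor <;> linarith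
  · exact (mod3_aux p z (t ^ 2) h2 (by linarith)).elim

lemma S1_coprime (k : ℕ) : ∀ u d v w : ℤ, (u * d).natAbs = k → IsCoprime u d →
    u * d ≠ 0 → u ^ 2 + d ^ 2 = v ^ 2 → u ^ 2 + 4 * d ^ 2 = w ^ 2 → False := by
  induction k using Nat.strong_induction_on with
  | _ k ih =>
  intro u d v w hk hc h0 e1 e2
  have hu : u ≠ 0 := left_ne_zero_of_mul h0
  have hd : d ≠ 0 := right_ne_zero_of_mul h0
  rcases Int.even_or_odd' u with ⟨u', hu' | hu'⟩
  · have hw : Even w := by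
      have : Even (w ^ 2) := ⟨2 * u' ^ 2 + 2 * d ^ 2, by rw [← e2, hu']; ring⟩
      exact (Int.even_pow' (by norm_num)).1 this
    obtain ⟨w', hw'⟩ := hw
    have hc' : IsCoprime d u' := by
      rw [hu'] at hc
      exact hc.symm.of_mul_right_right
    refine ih (d * u').natAbs ?_ d u' w' v rfl hc' ?_ ?_ ?_
    · rw [← hk, hu', Int.natAbs_mul, Int.natAbs_mul, Int.natAbs_mul]
      have : 0 < d.natAbs := Int.natAbs_pos.2 hd
      have : 0 < u'.natAbs := Int.natAbs_pos.2 (by rintro rfl; simp at hu'; exact hu hu')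
      have : 0 < d.natAbs * u'.natAbs := by positivity
      have : (2 : ℤ).natAbs * u'.natAbs * d.natAbs = 2 * (d.natAbs * u'.natAbs) := by
        change 2 * u'.natAbs * d.natAbs = _
        ring
      omega
    · exact mul_ne_zero hd (by rintro rfl; simp at hu'; exact hu hu')
    · subst hu' hw'; nlinarith
    · subst hu'; nlinarith
  · have hodd : u % 2 = 1 := by omega
    have hc2 : IsCoprime u (2 * d) := by
      refine IsCoprime.mul_right ?_ hc
      exact ⟨1, -u', by rw [hu']; ring⟩
    have hpos : ∀ x y : ℤ, u ^ 2 + y ^ 2 = x ^ 2 → 0 < |x| := by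
      intro x y hxy
      apply abs_pos.2
      rintro rfl
      have : 0 < u ^ 2 := by positivity
      nlinarith [sq_nonneg y]
    have P1 : PythagoreanTriple u d |v| := by
      unfold PythagoreanTriple; rw [abs_mul_abs_self]; linarith
    have P2 : PythagoreanTriple u (2 * d) |w| := by
      unfold PythagoreanTriple; rw [abs_mul_abs_self]; linarith
    obtain ⟨m, n, hm1, hm2, -, hmn, -, -⟩ := P1.coprime_classification'
      (Int.isCoprime_iff_gcd_eq_one.1 hc) hodd (hpos v d e1)
    obtain ⟨r, s, hr1, hr2, -, hrs, hpar, -⟩ := P2.coprime_classification'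
      (Int.isCoprime_iff_gcd_eq_one.1 hc2) hodd (hpos w (2 * d) (by linarith))
    rw [← Int.isCoprime_iff_gcd_eq_one] at hmn hrs
    have hfin : ∀ p q t z : ℤ, d = 2 * (p * q * t * z) → IsCoprime q t → IsCoprime p z →
        q ^ 2 * (p ^ 2 + z ^ 2) = t ^ 2 * (p ^ 2 + 4 * z ^ 2) → False := by
      intro p q t z hdd hqt hpz e
      have hp0 : p ≠ 0 := by rintro rfl; simp at hdd; exact hd hdd
      have hq0 : q ≠ 0 := by rintro rfl; simp at hdd; exact hd hdd
      have ht0 : t ≠ 0 := by rintro rfl; simp at hdd; exact hd hdd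
      have hz0 : z ≠ 0 := by rintro rfl; simp at hdd; exact hd hdd
      obtain ⟨f1, f2⟩ := core_aux p q t z hqt hpz ht0 hq0 e
      refine ih (p * z).natAbs ?_ p z t q rfl hpz (mul_ne_zero hp0 hz0) f1 f2
      have hh : u * d = (p * z) * (2 * (u * q * t)) := by rw [hdd]; ring
      rw [← hk, hh, Int.natAbs_mul (p * z), Int.natAbs_mul 2]
      have g1 : 0 < (p * z).natAbs := Int.natAbs_pos.2 (mul_ne_zero hp0 hz0)
      have g2 : 0 < (u * q * t).natAbs :=
        Int.natAbs_pos.2 (mul_ne_zero (mul_ne_zero hu hq0) ht0)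
      change _ < (p * z).natAbs * (2 * (u * q * t).natAbs)
      nlinarith
    rcases hpar with ⟨hre, hso⟩ | ⟨hro, hse⟩
    · obtain ⟨r', rfl⟩ : ∃ r', r = 2 * r' := ⟨r / 2, by omega⟩
      have hmul : s * r' = m * n := by linarith
      obtain ⟨p, q, ⟨t, rfl⟩, ⟨z, rfl⟩, rfl⟩ := exists_dvd_and_dvd_of_dvd_mul (Dvd.intro _ hmul)
      have hpq : p * q ≠ 0 := by
        intro hpq
        apply hd
        rw [hm2]; linear_combination 2 * t * z * hpq
      have hr' : r' = t * z := by
        apply mul_left_cancel₀ hpq; rw [hmul]; ring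
      subst hr'
      refine hfin q p z t (by rw [hm2]; ring) ?_ ?_ (by linear_combination hr1 - hm1)
      · exact hmn.of_mul_left_left.of_mul_right_right
      · exact hrs.symm.of_mul_left_right.of_mul_right_right.of_mul_right_left
    · obtain ⟨s', rfl⟩ : ∃ s', s = 2 * s' := ⟨s / 2, by omega⟩
      have hmul : r * s' = m * n := by linarith
      obtain ⟨p, q, ⟨t, rfl⟩, ⟨z, rfl⟩, rfl⟩ := exists_dvd_and_dvd_of_dvd_mul (Dvd.intro _ hmul)
      have hpq : p * q ≠ 0 := by
        intro hpq
        apply hd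
        rw [hm2]; linear_combination 2 * t * z * hpq
      have hr' : s' = t * z := by
        apply mul_left_cancel₀ hpq; rw [hmul]; ring
      subst hr'
      refine hfin p q t z (by rw [hm2]; ring) ?_ ?_ (by linear_combination hm1 - hr1)
      · exact hrs.of_mul_left_right.of_mul_right_right.of_mul_right_left
      · exact hmn.of_mul_left_left.of_mul_right_right

/-- A rational number whose square is an integer is an integer. -/
lemma rat_sq_int (x : ℚ) (n : ℤ) (h : x ^ 2 = n) : ∃ k : ℤ, x = k := by
  have : IsIntegral ℤ x := by
    apply IsIntegral.of_pow (n := 2) (by norm_num)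
    rw [h]
    exact isIntegral_algebraMap (R := ℤ) (A := ℚ) (x := n)
  obtain ⟨k, hk⟩ := IsIntegrallyClosed.isIntegral_iff.1 this
  exact ⟨k, by simpa using hk.symm⟩

lemma S1_rat (x c e : ℚ) (h1 : x ^ 2 + 1 = c ^ 2) (h2 : x ^ 2 + 4 = e ^ 2) : x = 0 := by
  by_contra hx
  have hD : (x.den : ℚ) ≠ 0 := by exact_mod_cast x.den_nz
  have hx' : x * x.den = x.num := Rat.mul_den_eq_num x
  obtain ⟨v, hv⟩ := rat_sq_int (c * x.den) (x.num ^ 2 + x.den ^ 2) (by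
    push_cast; rw [← hx']; linear_combination -(x.den : ℚ) ^ 2 * h1)
  obtain ⟨w, hw⟩ := rat_sq_int (e * x.den) (x.num ^ 2 + 4 * x.den ^ 2) (by
    push_cast; rw [← hx']; linear_combination -(x.den : ℚ) ^ 2 * h2)
  refine S1_coprime _ x.num x.den v w rfl ?_ ?_ ?_ ?_
  · rw [Int.isCoprime_iff_gcd_eq_one]; exact x.reduced
  · exact mul_ne_zero (Rat.num_ne_zero.2 hx) (by exact_mod_cast x.den_nz)
  · have : ((x.num : ℚ)) ^ 2 + (x.den : ℚ) ^ 2 = (v : ℚ) ^ 2 := by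
      rw [← hv, ← hx']; linear_combination (x.den : ℚ) ^ 2 * h1
    exact_mod_cast this
  · have : ((x.num : ℚ)) ^ 2 + 4 * (x.den : ℚ) ^ 2 = (w : ℚ) ^ 2 := by
      rw [← hw, ← hx']; linear_combination (x.den : ℚ) ^ 2 * h2
    exact_mod_cast this

/-- Four rational squares in arithmetic progression `d², w², v², u²` are equal. -/
lemma AP4 (d w v u : ℚ) (h1 : d ^ 2 + v ^ 2 = 2 * w ^ 2) (h2 : w ^ 2 + u ^ 2 = 2 * v ^ 2) :
    u ^ 2 = d ^ 2 := by
  obtain ⟨e, he⟩ : ∃ e, e = (v + d) / 2 := ⟨_, rfl⟩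
  obtain ⟨f, hf⟩ : ∃ f, f = (v - d) / 2 := ⟨_, rfl⟩
  have hv : v = e + f := by rw [he, hf]; ring
  have hd : d = e - f := by rw [he, hf]; ring
  clear he hf
  subst hv hd
  have k1 : w ^ 2 = e ^ 2 + f ^ 2 := by linarith
  have k2 : u ^ 2 = w ^ 2 + 4 * e * f := by linarith
  suffices hs : e * f = 0 by linear_combination k2 + k1 + 6 * hs
  by_contra hef
  have he : e ≠ 0 := left_ne_zero_of_mul hef
  have hf : f ≠ 0 := right_ne_zero_of_mul hef
  obtain ⟨t, ht⟩ : ∃ t, t = (u - w) / (2 * e) := ⟨_, rfl⟩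
  have a1 : u = w + 2 * e * t := by rw [ht]; field_simp; ring
  have a2 : t * w = f - e * t ^ 2 := by
    rw [a1] at k2
    apply mul_left_cancel₀ he
    linear_combination k2 / 4
  have ht0 : t ≠ 0 := by
    rintro rfl
    apply hf; linarith
  have a3 : f ^ 2 * (1 - t ^ 2) - 2 * e * f * t ^ 2 - e ^ 2 * t ^ 2 * (1 - t ^ 2) = 0 := by
    have : (f - e * t ^ 2) ^ 2 = t ^ 2 * (e ^ 2 + f ^ 2) := by rw [← a2, ← k1]; ring
    linear_combination this
  have a4 : (f * (1 - t ^ 2) - e * t ^ 2) ^ 2 = e ^ 2 * t ^ 2 * (t ^ 2 + (1 - t ^ 2) ^ 2) := by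
    linear_combination (1 - t ^ 2) * a3
  have := S1_rat ((1 - t ^ 2) / t) ((f * (1 - t ^ 2) - e * t ^ 2) / (e * t ^ 2))
    ((1 + t ^ 2) / t) (by
      rw [div_pow _ (e * t ^ 2), a4]; field_simp; ring) (by field_simp; ring)
  have h10 : 1 - t ^ 2 = 0 := by
    rcases div_eq_zero_iff.1 this with h | h
    · exact h
    · exact absurd h ht0
  rw [h10] at a3
  have : e * f * t ^ 2 = 0 := by linarith
  exact hef ((mul_eq_zero.1 this).resolve_right (pow_ne_zero _ ht0))

/-- If a product of positive integers is a square, each factor is the gcd times a square. -/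
lemma gcd_sq (a b c : ℤ) (ha : 0 < a) (hb : 0 < b) (h : a * b = c ^ 2) :
    ∃ g s : ℤ, 0 < g ∧ g ∣ a ∧ g ∣ b ∧ a = g * s ^ 2 := by
  obtain ⟨g, a1, b1, hg, hco, h1, h2⟩ := Int.exists_gcd_one' (m := a) (n := b)
    (Int.gcd_pos_of_ne_zero_left _ ha.ne')
  have hg' : (0 : ℤ) < g := by exact_mod_cast hg
  have hsq : (g : ℤ) ^ 2 ∣ c ^ 2 := ⟨a1 * b1, by rw [← h, h1, h2]; ring⟩
  obtain ⟨c', rfl⟩ := (Int.pow_dvd_pow_iff (by norm_num)).1 hsq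
  have : a1 * b1 = c' ^ 2 := by
    apply mul_left_cancel₀ (pow_ne_zero 2 hg'.ne')
    rw [← mul_pow, ← h, h1, h2]; ring
  obtain ⟨s, hs⟩ := Int.sq_of_gcd_eq_one hco this
  refine ⟨g, s, hg', ⟨a1, by rw [h1]; ring⟩, ⟨b1, by rw [h2]; ring⟩, ?_⟩
  rcases hs with hs | hs
  · rw [h1, hs]; ring
  · exfalso
    have : a1 ≤ 0 := by rw [hs]; nlinarith [sq_nonneg s]
    nlinarith

lemma pos_case (X Y : ℚ) (hX : 0 < X)
    (h : Y ^ 2 = X ^ 3 + 5 * X ^ 2 + 4 * X) : X = 2 := by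
  obtain ⟨N, hN⟩ : ∃ N, N = X.num := ⟨_, rfl⟩
  obtain ⟨D, hD⟩ : ∃ D : ℤ, D = X.den := ⟨_, rfl⟩
  have hN0 : 0 < N := by rw [hN]; exact Rat.num_pos.2 hX
  have hD0 : 0 < D := by rw [hD]; exact_mod_cast X.den_pos
  have hco : IsCoprime N D := by
    rw [hN, hD, Int.isCoprime_iff_gcd_eq_one]; exact X.reduced
  have hXD : X * D = N := by rw [hN, hD]; exact_mod_cast Rat.mul_den_eq_num X
  have hDq : (0 : ℚ) < D := by exact_mod_cast hD0
  obtain ⟨M, hM⟩ := rat_sq_int (Y * D ^ 2) (N * (N + D) * (N + 4 * D) * D) (by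
    push_cast; rw [← hXD]; linear_combination (D : ℚ) ^ 4 * h)
  have hM2 : N * (N + D) * (N + 4 * D) * D = M ^ 2 := by
    have : (N : ℚ) * (N + D) * (N + 4 * D) * D = (M : ℚ) ^ 2 := by
      rw [← hM, ← hXD]; linear_combination -(D : ℚ) ^ 4 * h
    exact_mod_cast this
  clear hM hN hD
  -- the denominator is a square
  have hcoD : IsCoprime D (N * (N + D) * (N + 4 * D)) := by
    refine IsCoprime.mul_right (IsCoprime.mul_right hco.symm ?_) ?_
    · obtain ⟨a, b, hab⟩ := hco
      exact ⟨b - a, a, by linear_combination hab⟩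
    · obtain ⟨a, b, hab⟩ := hco
      exact ⟨b - 4 * a, a, by linear_combination hab⟩
  obtain ⟨gd, d, hgd0, hgd1, hgd2, hd⟩ := gcd_sq D (N * (N + D) * (N + 4 * D)) M hD0
    (by positivity) (by rw [← hM2]; ring)
  have hgd : gd = 1 := by
    rcases Int.isUnit_iff.1 (hcoD.isUnit_of_dvd' hgd1 hgd2) with h | h <;> omega
  obtain ⟨gn, u, hgn0, hgn1, hgn2, hu⟩ := gcd_sq N (D * (N + D) * (N + 4 * D)) M hN0
    (by positivity) (by rw [← hM2]; ring)
  obtain ⟨gv, v, hgv0, hgv1, hgv2, hv⟩ := gcd_sq (N + D) (D * N * (N + 4 * D)) M (by positivity)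
    (by positivity) (by rw [← hM2]; ring)
  subst hgd
  have hgn : gn ∣ 4 := by
    have c1 : IsCoprime gn D := hco.of_isCoprime_of_dvd_left hgn1
    have c2 : IsCoprime gn (D * D * D) := (c1.mul_right c1).mul_right c1
    apply c2.dvd_of_dvd_mul_right
    have : 4 * (D * D * D) = D * (N + D) * (N + 4 * D) - N * (D * (N + 5 * D)) := by ring
    rw [this]
    exact dvd_sub hgn2 (hgn1.mul_right _)
  have hgv : gv ∣ 3 := by
    have c0 : IsCoprime (N + D) D := by
      obtain ⟨a, b, hab⟩ := hco
      exact ⟨a, b - a, by linear_combination hab⟩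
    have c1 : IsCoprime gv D := c0.of_isCoprime_of_dvd_left hgv1
    have c2 : IsCoprime gv (D * D * D) := (c1.mul_right c1).mul_right c1
    apply c2.dvd_of_dvd_mul_right
    have : 3 * (D * D * D) = (N + D) * (D * (N + 3 * D)) - D * N * (N + 4 * D) := by ring
    rw [this]
    exact dvd_sub (hgv1.mul_right _) hgv2
  have hN' : (∃ u, N = u ^ 2) ∨ (∃ u, N = 2 * u ^ 2) := by
    have : gn ≤ 4 := Int.le_of_dvd (by norm_num) hgn
    have : gn = 1 ∨ gn = 2 ∨ gn = 4 := by interval_cases gn <;> omega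
    rcases this with rfl | rfl | rfl
    · exact Or.inl ⟨u, by linarith⟩
    · exact Or.inr ⟨u, by linarith⟩
    · exact Or.inl ⟨2 * u, by linarith⟩
  have hV' : (N + D = v ^ 2) ∨ (N + D = 3 * v ^ 2) := by
    have : gv ≤ 3 := Int.le_of_dvd (by norm_num) hgv
    have : gv = 1 ∨ gv = 3 := by interval_cases gv <;> omega
    rcases this with rfl | rfl
    · exact Or.inl (by linarith)
    · exact Or.inr (by linarith)
  clear hu hv hgn hgv hgn1 hgn2 hgv1 hgv2 hgn0 hgv0
  rw [one_mul] at hd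
  subst hd
  have hd0 : d ≠ 0 := by rintro rfl; simp at hD0
  have hcod : ∀ u, N = u ^ 2 ∨ N = 2 * u ^ 2 → IsCoprime u d := by
    intro u hu
    have : IsCoprime N d := (IsCoprime.pow_right_iff (by norm_num)).1 hco
    refine this.of_isCoprime_of_dvd_left ?_
    rcases hu with hu | hu
    · exact ⟨u, by rw [hu]; ring⟩
    · exact ⟨2 * u, by rw [hu]; ring⟩
  have hdq : (d : ℚ) ≠ 0 := by exact_mod_cast hd0
  have hpv : N + d ^ 2 ≠ 0 := by positivity
  rcases hN' with ⟨u, hu⟩ | ⟨u, hu⟩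
  · have hcu := hcod u (Or.inl hu)
    have hu0 : u ≠ 0 := by rintro rfl; simp at hu; omega
    rcases hV' with hv | hv
    · exfalso
      have hv0 : v ≠ 0 := by rintro rfl; simp at hv; exact hpv hv
      have : (u * v * d) ^ 2 ∣ M ^ 2 := ⟨N + 4 * d ^ 2, by
        rw [← hM2, hv]; nth_rewrite 1 [hu]; ring⟩
      obtain ⟨k, rfl⟩ := (Int.pow_dvd_pow_iff (by norm_num)).1 this
      have hk : N + 4 * d ^ 2 = k ^ 2 := by
        apply mul_left_cancel₀ (pow_ne_zero 2 (mul_ne_zero (mul_ne_zero hu0 hv0) hd0))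
        rw [← mul_pow, ← hM2, hv]; nth_rewrite 2 [hu]; ring
      rw [hu] at hv hk
      exact S1_coprime _ u d v k rfl hcu (mul_ne_zero hu0 hd0) hv hk
    · rw [hu] at hv
      exact (mod3_aux u d _ hcu hv).elim
  · have hcu := hcod u (Or.inr hu)
    have hu0 : u ≠ 0 := by rintro rfl; simp at hu; omega
    have huq : (u : ℚ) ≠ 0 := by exact_mod_cast hu0
    have hv0 : v ≠ 0 := by
      rintro rfl
      rcases hV' with hv | hv <;> simp at hv <;> exact hpv hv
    have hvq : (v : ℚ) ≠ 0 := by exact_mod_cast hv0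
    rcases hV' with hv | hv
    · exfalso
      rw [hu] at hv hM2
      rw [hv] at hM2
      obtain ⟨k, hk⟩ := rat_sq_int ((M : ℚ) / (2 * u * v * d)) (u ^ 2 + 2 * d ^ 2) (by
        have : (M : ℚ) ^ 2 = 2 * u ^ 2 * v ^ 2 * (2 * u ^ 2 + 4 * d ^ 2) * d ^ 2 := by
          exact_mod_cast hM2.symm
        rw [div_pow, this]; push_cast; field_simp; ring)
      have hk2 : u ^ 2 + 2 * d ^ 2 = k ^ 2 := by
        have h2 : (M : ℚ) ^ 2 = 2 * u ^ 2 * v ^ 2 * (2 * u ^ 2 + 4 * d ^ 2) * d ^ 2 := by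
          exact_mod_cast hM2.symm
        have : (u : ℚ) ^ 2 + 2 * d ^ 2 = (k : ℚ) ^ 2 := by
          rw [← hk, div_pow, h2]; field_simp; ring
        exact_mod_cast this
      -- parity
      have hnot : ¬ (2 ∣ u ∧ 2 ∣ d) := by
        rintro ⟨a, b⟩
        have := hcu.isUnit_of_dvd' a b
        rw [Int.isUnit_iff] at this
        omega
      have m1 : (2 * u ^ 2 + d ^ 2) % 4 = v ^ 2 % 4 := by rw [hv]
      have m2 : (u ^ 2 + 2 * d ^ 2) % 4 = k ^ 2 % 4 := by rw [hk2]
      have sq : ∀ x : ℤ, (x % 2 = 0 ∧ x ^ 2 % 4 = 0) ∨ (x % 2 = 1 ∧ x ^ 2 % 4 = 1) := by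
        intro x
        rcases Int.even_or_odd' x with ⟨y, hy | hy⟩
        · left; constructor
          · omega
          · rw [hy]; ring_nf; omega
        · right; constructor
          · omega
          · rw [hy]; ring_nf; omega
      have := sq u
      have := sq d
      have := sq v
      have := sq k
      omega
    · rw [hu] at hv hM2
      rw [hv] at hM2
      have h2 : (M : ℚ) ^ 2 = 2 * u ^ 2 * (3 * v ^ 2) * (2 * u ^ 2 + 4 * d ^ 2) * d ^ 2 := by
        exact_mod_cast hM2.symm
      have h3 : ((M : ℚ) / (6 * u * v * d)) ^ 2 = (u ^ 2 + 2 * d ^ 2) / 3 := by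
        rw [div_pow, h2]; field_simp; ring
      have h4 : 2 * (u : ℚ) ^ 2 + d ^ 2 = 3 * v ^ 2 := by exact_mod_cast hv
      have h5 := AP4 (d : ℚ) ((M : ℚ) / (6 * u * v * d)) v u
        (by rw [h3]; linarith) (by rw [h3]; linarith)
      rw [hu] at hXD
      push_cast at hXD
      rw [h5] at hXD
      exact mul_right_cancel₀ (pow_ne_zero 2 hdq) hXD

theorem rational_points_X0_24 (X Y : ℚ) (hY : Y ≠ 0)
    (h : Y ^ 2 = X ^ 3 + 5 * X ^ 2 + 4 * X) :
    (X = -2 ∧ (Y = 2 ∨ Y = -2)) ∨ (X = 2 ∧ (Y = 6 ∨ Y = -6)) := by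
  have hpos : 0 < X * (X + 1) * (X + 4) := by
    have : 0 < Y ^ 2 := by positivity
    linarith
  rcases lt_or_ge 0 X with hX | hX
  · have := pos_case X Y hX h
    subst this
    right
    refine ⟨rfl, ?_⟩
    have : (Y - 6) * (Y + 6) = 0 := by linear_combination h
    rcases mul_eq_zero.1 this with h | h
    · left; linarith
    · right; linarith
  · have hX1 : X + 1 < 0 := by
      by_contra hn
      push Not at hn
      have : 0 ≤ -X * (X + 1) * (X + 4) :=
        mul_nonneg (mul_nonneg (by linarith) hn) (by linarith)
      linarith
    have hX4 : 0 < X + 4 := by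
      by_contra hn
      push Not at hn
      have : 0 ≤ (-X) * (-(X + 1)) * (-(X + 4)) :=
        mul_nonneg (mul_nonneg (by linarith) (by linarith)) (by linarith)
      linarith
    have hne : X + 1 ≠ 0 := hX1.ne
    have := pos_case (-(X + 4) / (X + 1)) (3 * Y / (X + 1) ^ 2)
      (div_pos_of_neg_of_neg (by linarith) hX1) (by
        rw [div_pow, mul_pow, h]; field_simp; ring)
    rw [div_eq_iff hne] at this
    have hX2 : X = -2 := by linarith
    subst hX2
    left
    refine ⟨rfl, ?_⟩
    have : (Y - 2) * (Y + 2) = 0 := by linear_combination h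
    rcases mul_eq_zero.1 this with h | h
    · left; linarith
    · right; linarith
end

section
/- If {y₁, y₂, ..., yₙ} ⊆ ℚ are n ≥ 4 squares of rationals in arithmetic progression (with yᵢ₊₁ − yᵢ constant), not all zero, then y₁ = y₂ = ⋯ = yₙ (the progression is constant). -/
/-- The descent step: a solution of `s² - 4p² = u² - v²`, `s p = u v` with `u, v` coprime gives a
new pair `(γ, β)` with `γ² + β²` and `γ² + 4 β²` both squares. -/
lemma fourSq_step (s p u v : ℤ) (hu : u ≠ 0) (hv : v ≠ 0) (huv : IsCoprime u v)
    (h1 : s * p = u * v) (h2 : s ^ 2 - 4 * p ^ 2 = u ^ 2 - v ^ 2) :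
    ∃ g b a d : ℤ, g * b ∣ u * v ∧ g ≠ 0 ∧ b ≠ 0 ∧ g ^ 2 + b ^ 2 = a ^ 2 ∧
      g ^ 2 + 4 * b ^ 2 = d ^ 2 := by
  obtain ⟨g, d, ⟨a, rfl⟩, ⟨b, rfl⟩, rfl⟩ := exists_dvd_and_dvd_of_dvd_mul (Dvd.intro p h1)
  have hg : g ≠ 0 := left_ne_zero_of_mul hu
  have ha : a ≠ 0 := right_ne_zero_of_mul hu
  have hd : d ≠ 0 := left_ne_zero_of_mul hv
  have hb : b ≠ 0 := right_ne_zero_of_mul hv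
  have hp : p = a * b := by
    have : (g * d) * p = (g * d) * (a * b) := by linear_combination h1
    exact mul_left_cancel₀ (mul_ne_zero hg hd) this
  subst hp
  have had : IsCoprime a d := huv.of_mul_left_right.of_mul_right_left
  have hgb : IsCoprime g b := huv.of_mul_left_left.of_mul_right_right
  have key : d ^ 2 * (g ^ 2 + b ^ 2) = a ^ 2 * (g ^ 2 + 4 * b ^ 2) := by linear_combination h2
  have hdvd : a ^ 2 ∣ g ^ 2 + b ^ 2 :=
    (had.pow (m := 2) (n := 2)).dvd_of_dvd_mul_left (Dvd.intro _ key.symm)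
  obtain ⟨k, hk⟩ := hdvd
  have hk2 : g ^ 2 + 4 * b ^ 2 = d ^ 2 * k := by
    have : a ^ 2 * (g ^ 2 + 4 * b ^ 2) = a ^ 2 * (d ^ 2 * k) := by
      rw [← key, hk]; ring
    exact mul_left_cancel₀ (pow_ne_zero 2 ha) this
  have hkpos : 0 < k := by
    have h0 : 0 < g ^ 2 + b ^ 2 := by positivity
    have h3 : 0 < a ^ 2 := by positivity
    rw [hk] at h0
    exact (pos_iff_pos_of_mul_pos h0).1 h3
  have hk3 : k ∣ 3 := by
    have hA : k ∣ 3 * b ^ 2 := ⟨d ^ 2 - a ^ 2, by linear_combination hk2 - hk⟩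
    have hB : k ∣ 3 * g ^ 2 := ⟨4 * a ^ 2 - d ^ 2, by linear_combination 4 * hk - hk2⟩
    obtain ⟨x, y, hxy⟩ := hgb.pow (m := 2) (n := 2)
    have : (3 : ℤ) = x * (3 * g ^ 2) + y * (3 * b ^ 2) := by linear_combination -3 * hxy
    rw [this]
    exact dvd_add (hB.mul_left _) (hA.mul_left _)
  have hk1 : k = 1 := by
    have hle := Int.le_of_dvd (by norm_num) hk3
    have hcases : k = 1 ∨ k = 2 ∨ k = 3 := by omega
    rcases hcases with h | h | h
    · exact h
    · subst h; norm_num at hk3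
    · subst h
      exfalso
      have hm : (g ^ 2 + b ^ 2) % 3 = 0 := by rw [hk]; omega
      have hg3 : (3 : ℤ) ∣ g ∧ (3 : ℤ) ∣ b := by
        have e1 : g % 3 = 0 ∨ g % 3 = 1 ∨ g % 3 = 2 := by omega
        have e2 : b % 3 = 0 ∨ b % 3 = 1 ∨ b % 3 = 2 := by omega
        rcases e1 with e1 | e1 | e1 <;> rcases e2 with e2 | e2 | e2 <;>
          simp [pow_two, Int.add_emod, Int.mul_emod, e1, e2] at hm <;>
          exact ⟨Int.dvd_of_emod_eq_zero e1, Int.dvd_of_emod_eq_zero e2⟩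
      have := hgb.isUnit_of_dvd' hg3.1 hg3.2
      norm_num [Int.isUnit_iff] at this
  subst hk1
  exact ⟨g, b, a, d, ⟨a * d, by ring⟩, hg, hb, by linear_combination hk, by linear_combination hk2⟩

lemma fourSq_int (n : ℕ) : ∀ g b a d : ℤ, (g * b).natAbs = n → g ≠ 0 → b ≠ 0 →
    g ^ 2 + b ^ 2 = a ^ 2 → g ^ 2 + 4 * b ^ 2 = d ^ 2 → False := by
  induction n using Nat.strong_induction_on with
  | _ n ih =>
  intro g b a d hn hg hb h1 h2
  have hlt : ∀ x y : ℤ, x ≠ 0 → 1 < y.natAbs → g * b = x * y → x.natAbs < n := by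
    intro x y hx hy h
    rw [← hn, h, Int.natAbs_mul]
    have : 0 < x.natAbs := Int.natAbs_pos.2 hx
    nlinarith
  by_cases hc : IsCoprime g b
  swap
  · set k : ℤ := (Int.gcd g b : ℤ) with hkdef
    have hk0 : k ≠ 0 := by
      rw [hkdef]; exact_mod_cast (Int.gcd_pos_of_ne_zero_left b hg).ne'
    have hk1 : k.natAbs ≠ 1 := by
      rw [hkdef, Int.natAbs_natCast]
      exact fun h => hc (Int.isCoprime_iff_gcd_eq_one.2 h)
    have hkp : 0 < k.natAbs := Int.natAbs_pos.2 hk0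
    obtain ⟨g', hg'⟩ : k ∣ g := Int.gcd_dvd_left ..
    obtain ⟨b', hb'⟩ : k ∣ b := Int.gcd_dvd_right ..
    obtain ⟨a', ha'⟩ : k ∣ a := (Int.pow_dvd_pow_iff two_ne_zero).1
      ⟨g' ^ 2 + b' ^ 2, by rw [← h1, hg', hb']; ring⟩
    obtain ⟨d', hd'⟩ : k ∣ d := (Int.pow_dvd_pow_iff two_ne_zero).1
      ⟨g' ^ 2 + 4 * b' ^ 2, by rw [← h2, hg', hb']; ring⟩
    have hg0 : g' ≠ 0 := by rintro rfl; simp [hg'] at hg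
    have hb0 : b' ≠ 0 := by rintro rfl; simp [hb'] at hb
    have hkk : k ^ 2 ≠ 0 := pow_ne_zero 2 hk0
    refine ih _ (hlt (g' * b') (k * k) (mul_ne_zero hg0 hb0) ?_ ?_) g' b' a' d' rfl hg0 hb0 ?_ ?_
    · rw [Int.natAbs_mul]
      have : 2 ≤ k.natAbs := by omega
      nlinarith
    · rw [hg', hb']; ring
    · apply mul_left_cancel₀ hkk
      rw [hg', hb', ha'] at h1
      linear_combination h1
    · apply mul_left_cancel₀ hkk
      rw [hg', hb', hd'] at h2
      linear_combination h2
  rcases Int.even_or_odd' g with ⟨g', hg' | hodd⟩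
  · obtain ⟨d', hd'⟩ : (2 : ℤ) ∣ d := (Int.pow_dvd_pow_iff two_ne_zero).1
      ⟨g' ^ 2 + b ^ 2, by rw [← h2, hg']; ring⟩
    have hg0 : g' ≠ 0 := by rintro rfl; simp [hg'] at hg
    refine ih _ (hlt (b * g') 2 (mul_ne_zero hb hg0) (by norm_num) (by rw [hg']; ring))
      b g' d' a rfl hb hg0 ?_ ?_
    · rw [hg', hd'] at h2
      linarith
    · rw [hg'] at h1
      linarith
  have hg2 : g % 2 = 1 := by omega
  have ha0 : a ≠ 0 := by
    rintro rfl
    have : 0 < g ^ 2 + b ^ 2 := by positivity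
    simp [h1] at this
  have hd0 : d ≠ 0 := by
    rintro rfl
    have : 0 < g ^ 2 + 4 * b ^ 2 := by positivity
    simp [h2] at this
  have hc2 : IsCoprime g (2 * b) := by
    refine IsCoprime.mul_right ⟨1, -g', by rw [hodd]; ring⟩ hc
  have P1 : PythagoreanTriple g b |a| := by
    unfold PythagoreanTriple; rw [abs_mul_abs_self]; linear_combination h1
  have P2 : PythagoreanTriple g (2 * b) |d| := by
    unfold PythagoreanTriple; rw [abs_mul_abs_self]; linear_combination h2
  obtain ⟨m, n', e1, e2, -, e3, -⟩ := P1.coprime_classification'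
    (Int.isCoprime_iff_gcd_eq_one.1 hc) hg2 (abs_pos.2 ha0)
  obtain ⟨M, N, f1, f2, -, -, -⟩ := P2.coprime_classification'
    (Int.isCoprime_iff_gcd_eq_one.1 hc2) hg2 (abs_pos.2 hd0)
  have hcop : IsCoprime m n' := Int.isCoprime_iff_gcd_eq_one.2 e3
  have hm : m ≠ 0 := by rintro rfl; simp [e2] at hb
  have hn' : n' ≠ 0 := by rintro rfl; simp [e2] at hb
  have hMN : M * N = 2 * (m * n') := by linarith
  have hfin : ∀ x y z w : ℤ, x * y ∣ m * n' → x ≠ 0 → y ≠ 0 → x ^ 2 + y ^ 2 = z ^ 2 →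
      x ^ 2 + 4 * y ^ 2 = w ^ 2 → False := by
    rintro x y z w ⟨t, ht⟩ hx hy q1 q2
    have ht0 : t ≠ 0 := by
      rintro rfl
      exact mul_ne_zero hm hn' (by simpa using ht)
    refine ih _ (hlt (x * y) (2 * (t * g)) (mul_ne_zero hx hy) ?_ ?_) x y z w rfl hx hy q1 q2
    · have := Int.natAbs_pos.2 (mul_ne_zero ht0 hg)
      omega
    · rw [e2]; linear_combination 2 * g * ht
  rcases Int.prime_two.dvd_or_dvd (Dvd.intro _ hMN.symm) with ⟨M', rfl⟩ | ⟨N', rfl⟩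
  · obtain ⟨x, y, z, w, q0, q1, q2, q3, q4⟩ := fourSq_step N M' n' m hn' hm hcop.symm
      (by linarith) (by linarith)
    exact hfin x y z w (by rwa [mul_comm m]) q1 q2 q3 q4
  · obtain ⟨x, y, z, w, q0, q1, q2, q3, q4⟩ := fourSq_step M N' m n' hm hn' hcop
      (by linarith) (by linarith)
    exact hfin x y z w q0 q1 q2 q3 q4

lemma fourSq_rat_sq_int (x : ℚ) (k : ℤ) (h : x ^ 2 = k) : ∃ z : ℤ, k = z ^ 2 := by
  have : IsSquare (k : ℚ) := ⟨x, by rw [← h, sq]⟩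
  obtain ⟨z, hz⟩ := Rat.isSquare_intCast_iff.1 this
  exact ⟨z, by rw [hz, sq]⟩

lemma fourSq_rat (g b a d : ℚ) (hg : g ≠ 0) (hb : b ≠ 0)
    (h1 : g ^ 2 + b ^ 2 = a ^ 2) (h2 : g ^ 2 + 4 * b ^ 2 = d ^ 2) : False := by
  have hG : g * (g.den * b.den) = ((g.num * b.den : ℤ) : ℚ) := by
    push_cast; rw [← mul_assoc, Rat.mul_den_eq_num]
  have hB : b * (g.den * b.den) = ((b.num * g.den : ℤ) : ℚ) := by
    push_cast; rw [mul_comm (g.den : ℚ), ← mul_assoc, Rat.mul_den_eq_num]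
  obtain ⟨A, hA⟩ := fourSq_rat_sq_int (a * (g.den * b.den))
    ((g.num * b.den) ^ 2 + (b.num * g.den) ^ 2) (by
      rw [Int.cast_add, Int.cast_pow, Int.cast_pow, ← hG, ← hB, mul_pow, ← h1]; ring)
  obtain ⟨D, hD⟩ := fourSq_rat_sq_int (d * (g.den * b.den))
    ((g.num * b.den) ^ 2 + 4 * (b.num * g.den) ^ 2) (by
      rw [Int.cast_add, Int.cast_mul, Int.cast_pow, Int.cast_pow, ← hG, ← hB, mul_pow, ← h2]
      push_cast; ring)
  refine fourSq_int _ _ _ A D rfl ?_ ?_ hA hD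
  · exact mul_ne_zero (Rat.num_ne_zero.2 hg) (by exact_mod_cast b.den_nz)
  · exact mul_ne_zero (Rat.num_ne_zero.2 hb) (by exact_mod_cast g.den_nz)

lemma fourSq_two (a b : ℚ) (h : a ^ 2 = 2 * b ^ 2) : b = 0 := by
  by_contra hb
  have h2 : (a / b) ^ 2 = ((2 : ℤ) : ℚ) := by
    rw [div_pow, h]; field_simp; norm_num
  obtain ⟨z, hz⟩ := fourSq_rat_sq_int _ _ h2
  have : z < 2 := by nlinarith
  have : -2 < z := by nlinarith
  interval_cases z <;> omega

lemma fourSq_diff (a b c d D : ℚ) (h1 : b ^ 2 = a ^ 2 + D) (h2 : c ^ 2 = a ^ 2 + 2 * D)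
    (h3 : d ^ 2 = a ^ 2 + 3 * D) : D = 0 := by
  by_cases ha : a = 0
  · subst ha
    have := fourSq_two c b (by linarith)
    subst this; linarith
  by_cases hd : d = 0
  · subst hd
    have := fourSq_two b c (by linarith)
    subst this; linarith
  by_cases hb : b = 0
  · subst hb; nlinarith [sq_nonneg a, sq_nonneg c]
  by_cases hc : c = 0
  · subst hc; nlinarith [sq_nonneg b, sq_nonneg d]
  by_contra hD
  refine fourSq_rat (d ^ 4 - a ^ 4) (3 * a * b * c * d) (d ^ 4 + a ^ 2 * d ^ 2 + a ^ 4)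
    (d ^ 4 + 4 * a ^ 2 * d ^ 2 + a ^ 4) ?_ ?_ ?_ ?_
  · have : d ^ 4 - a ^ 4 = 3 * D * (d ^ 2 + a ^ 2) := by linear_combination (d ^ 2 + a ^ 2) * h3
    rw [this]; positivity
  · positivity
  · have e : (3 * a * b * c * d) ^ 2 = 9 * a ^ 2 * b ^ 2 * c ^ 2 * d ^ 2 := by ring
    rw [e, show d ^ 4 = (d ^ 2) ^ 2 by ring, h1, h2, h3]; ring
  · have e : (3 * a * b * c * d) ^ 2 = 9 * a ^ 2 * b ^ 2 * c ^ 2 * d ^ 2 := by ring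
    rw [e, show d ^ 4 = (d ^ 2) ^ 2 by ring, h1, h2, h3]; ring

theorem no_nonconstant_AP_of_four_squares (n : ℕ) (hn : 4 ≤ n) (y : Fin n → ℚ)
    (hsq : ∀ i, ∃ x : ℚ, y i = x ^ 2)
    (hAP : ∃ d : ℚ, ∀ i : ℕ, ∀ h : i + 1 < n, y ⟨i + 1, h⟩ - y ⟨i, Nat.lt_of_succ_lt h⟩ = d)
    (hnz : ∃ i, y i ≠ 0) :
    ∀ i j, y i = y j := by
  obtain ⟨D, hD⟩ := hAP
  have hy : ∀ i : ℕ, ∀ h : i < n, y ⟨i, h⟩ = y ⟨0, by omega⟩ + i * D := by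
    intro i
    induction i with
    | zero => intro h; simp
    | succ k ih =>
      intro h
      have e1 := hD k h
      have e2 := ih (by omega)
      push_cast
      linarith
  obtain ⟨a, ha⟩ := hsq ⟨0, by omega⟩
  obtain ⟨b, hb⟩ := hsq ⟨1, by omega⟩
  obtain ⟨c, hc⟩ := hsq ⟨2, by omega⟩
  obtain ⟨d, hd⟩ := hsq ⟨3, by omega⟩
  rw [hy, ha] at hb hc hd
  push_cast at hb hc hd
  have h0 : D = 0 := fourSq_diff a b c d D (by linarith) (by linarith) (by linarith)
  rintro ⟨i, hi⟩ ⟨j, hj⟩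
  rw [hy i hi, hy j hj, h0]; simp
end
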